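/- Let d ≥ 2 and let n be a positive integer having no prime divisor less than 2^d. Define F : (ZMod n)^(d−1) → (ZMod n)^d by F(t₁,…,t_{d−1}) = (t₁, −2t₁ + t₂, −2t₂ + t₃, …, −2t_{d−2} + t_{d−1}, −2t_{d−1}). Then F is injective and its image is a conflict-free set (of n^(d−1) cells) in (ZMod n)^d. -/

import Mathlib

/-- Two cells `p q` of the toroidal board `(ZMod n)^d` are in conflict as toroidal queens
if `q - p` is a scalar multiple `t • ε` of some nonzero direction vector `ε` all of whose
entries are images in `ZMod n` of `-1`, `0` or `1`. -/
def ConflictD {n d : ℕ} (p q : Fin d → ZMod n) : Prop :=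
  ∃ ε : Fin d → ZMod n,
    (∀ i, ε i = -1 ∨ ε i = 0 ∨ ε i = 1) ∧ ε ≠ 0 ∧
    ∃ t : ZMod n, ∀ i, q i - p i = t * ε i

/-- A set of cells is conflict-free if no two distinct cells of it are in conflict. -/
def ConflictFreeD {n d : ℕ} (S : Set (Fin d → ZMod n)) : Prop :=
  ∀ p ∈ S, ∀ q ∈ S, p ≠ q → ¬ ConflictD p q

/-- The map `F(t₁,…,t_{d−1}) = (t₁, −2t₁ + t₂, −2t₂ + t₃, …, −2t_{d−2} + t_{d−1}, −2t_{d−1})`. -/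
def queenF (n d : ℕ) (t : Fin (d - 1) → ZMod n) : Fin d → ZMod n := fun i =>
  (if h : (i : ℕ) < d - 1 then t ⟨(i : ℕ), h⟩ else 0) +
  (if h : 1 ≤ (i : ℕ) then (-2) * t ⟨(i : ℕ) - 1, by have := i.isLt; omega⟩ else 0)

/-- Horner evaluation at 2. -/
def hornerS {R : Type} [CommRing R] (x : ℕ → R) : ℕ → R
  | 0 => 0
  | k + 1 => 2 * hornerS x k + x k

/-- Extension by zero. -/
def extZ {R : Type} [CommRing R] {d : ℕ} (x : Fin d → R) : ℕ → R :=
  fun k => if h : k < d then x ⟨k, h⟩ else 0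

lemma hornerS_queenF (n d : ℕ) (t : Fin (d - 1) → ZMod n) (k : ℕ) (hk : k < d) :
    hornerS (extZ (queenF n d t)) (k + 1) = extZ t k := by
  induction k with
  | zero => simp [hornerS, extZ, queenF, hk]
  | succ k ih =>
    rw [hornerS, ih (by omega)]
    have h1 : k < d - 1 := by omega
    simp [extZ, queenF, hk, h1]

lemma hornerS_sub_mul {R : Type} [CommRing R] (x y e : ℕ → R) (t : R) (k : ℕ)
    (h : ∀ i < k, y i - x i = t * e i) :
    hornerS y k - hornerS x k = t * hornerS e k := by
  induction k with
  | zero => simp [hornerS]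
  | succ k ih =>
    have h1 := ih (fun i hi => h i (by omega))
    have h2 := h k (by omega)
    simp only [hornerS]
    linear_combination 2 * h1 + h2

lemma hornerS_cast {n : ℕ} (e : ℕ → ℤ) (k : ℕ) :
    ((hornerS e k : ℤ) : ZMod n) = hornerS (fun i => (e i : ZMod n)) k := by
  induction k with
  | zero => simp [hornerS]
  | succ k ih => simp [hornerS, ih]

lemma hornerS_bound (e : ℕ → ℤ) (he : ∀ i, e i = -1 ∨ e i = 0 ∨ e i = 1) (k : ℕ) :
    |hornerS e k| < 2 ^ k := by
  induction k with
  | zero => simp [hornerS]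
  | succ k ih =>
    rw [abs_lt] at *
    have := he k
    simp only [hornerS, pow_succ]
    omega

lemma hornerS_zero (e : ℕ → ℤ) (he : ∀ i, e i = -1 ∨ e i = 0 ∨ e i = 1) (k : ℕ)
    (h : hornerS e k = 0) : ∀ i < k, e i = 0 := by
  induction k with
  | zero => intro i hi; omega
  | succ k ih =>
    simp only [hornerS] at h
    have := he k
    intro i hi
    rcases Nat.lt_succ_iff_lt_or_eq.mp hi with h1 | rfl
    · exact ih (by omega) i h1
    · omega

lemma queenF_inj (n d : ℕ) : Function.Injective (queenF n d) := by
  intro s t h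
  funext i
  have h1 := hornerS_queenF n d s i (by omega)
  have h2 := hornerS_queenF n d t i (by omega)
  rw [h, h2] at h1
  simpa [extZ] using h1.symm

lemma isUnit_of_small (n d : ℕ) (hp : ∀ p : ℕ, p.Prime → p ∣ n → 2 ^ d ≤ p)
    (N : ℤ) (h0 : N ≠ 0) (hN : |N| < 2 ^ d) : IsUnit (N : ZMod n) := by
  have hc : Nat.Coprime N.natAbs n := by
    refine Nat.coprime_of_dvd fun p hpp h1 h2 => ?_
    have h3 := hp p hpp h2
    have h4 := Nat.le_of_dvd (Int.natAbs_pos.mpr h0) h1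
    have h5 : (N.natAbs : ℤ) < ((2 ^ d : ℕ) : ℤ) := by
      rw [Int.natCast_natAbs]; push_cast; exact hN
    have h6 : N.natAbs < 2 ^ d := by exact_mod_cast h5
    omega
  have hu := (ZMod.isUnit_iff_coprime N.natAbs n).mpr hc
  rcases Int.natAbs_eq N with h | h
  · rw [h]; simpa only [Int.cast_natCast] using hu
  · rw [h]; simpa only [Int.cast_neg, Int.cast_natCast, IsUnit.neg_iff] using hu

lemma queenF_free (n d : ℕ) (hd : 2 ≤ d)
    (hp : ∀ p : ℕ, p.Prime → p ∣ n → 2 ^ d ≤ p) :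
    ConflictFreeD (Set.range (queenF n d)) := by
  rintro _ ⟨a, rfl⟩ _ ⟨b, rfl⟩ hne ⟨ε, hε, hε0, t, ht⟩
  have hlift : ∀ i : Fin d, ∃ z : ℤ, (z = -1 ∨ z = 0 ∨ z = 1) ∧ (z : ZMod n) = ε i := by
    intro i
    rcases hε i with h | h | h
    · exact ⟨-1, by simp, by simp [h]⟩
    · exact ⟨0, by simp, by simp [h]⟩
    · exact ⟨1, by simp, by simp [h]⟩
  choose z hz hzε using hlift
  have he : ∀ i, extZ z i = -1 ∨ extZ z i = 0 ∨ extZ z i = 1 := by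
    intro i
    unfold extZ
    split_ifs with h
    · exact hz _
    · simp
  have hN0 : hornerS (extZ z) d ≠ 0 := by
    intro h
    apply hε0
    funext i
    have := hornerS_zero _ he d h i i.isLt
    simp only [extZ, i.isLt, dite_true] at this
    rw [← hzε i, this]; simp
  have hu := isUnit_of_small n d hp _ hN0 (hornerS_bound _ he d)
  have hsub := hornerS_sub_mul (extZ (queenF n d a)) (extZ (queenF n d b))
    (fun i => ((extZ z i : ℤ) : ZMod n)) t d (by
      intro i hi
      simp only [extZ, hi, dite_true, hzε, ht])
  obtain ⟨m, rfl⟩ : ∃ m, d = m + 1 := ⟨d - 1, by omega⟩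
  rw [← hornerS_cast, hornerS_queenF _ _ _ _ (by omega), hornerS_queenF _ _ _ _ (by omega)] at hsub
  have ht0 : t = 0 := by
    have h : t * ((hornerS (extZ z) (m + 1) : ℤ) : ZMod n) = 0 := by
      rw [← hsub]; simp [extZ]
    exact (hu.mul_left_eq_zero).mp h
  apply hne
  funext i
  have := ht i
  rw [ht0, zero_mul, sub_eq_zero] at this
  exact this.symm

theorem queens_full_construction (n d : ℕ) (hn : 0 < n) (hd : 2 ≤ d)
    (hp : ∀ p : ℕ, p.Prime → p ∣ n → 2 ^ d ≤ p) :
    Function.Injective (queenF n d) ∧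
    ConflictFreeD (Set.range (queenF n d)) ∧
    (Set.range (queenF n d)).ncard = n ^ (d - 1) := by
  haveI : NeZero n := ⟨by omega⟩
  refine ⟨queenF_inj n d, queenF_free n d hd hp, ?_⟩
  rw [← Set.image_univ, Set.ncard_image_of_injective _ (queenF_inj n d), Set.ncard_univ]
  simp [Nat.card_eq_fintype_card, ZMod.card]
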